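/- Let f ∈ ℂ[x,y] be a square-free binary quartic. Then the stabilizer Stab(f) ⊂ SL(2,ℂ) has order 8, 16, or 24. It has order greater than 8 if and only if f is SL(2,ℂ)-equivalent up to a nonzero scalar to x⁴+y⁴ (in which case the order is 16) or to x⁴ + 2√−3·x²y² + y⁴ (in which case the order is 24), and these two cases are mutually exclusive. -/

import Mathlib

open MvPolynomial Matrix

noncomputable section

/-- Polynomials in two variables `x = X 0`, `y = X 1` over `ℂ`. -/
abbrev BPoly : Type := MvPolynomial (Fin 2) ℂ

/-- The variable `x`. -/
def Px : BPoly := X 0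

/-- The variable `y`. -/
def Py : BPoly := X 1

/-- Substitution action of a 2×2 matrix on polynomials in two variables:
for `A = [[p,q],[r,s]]`, `(f·A)(x,y) = f(px+qy, rx+sy)`. -/
def matAct (A : Matrix (Fin 2) (Fin 2) ℂ) (f : BPoly) : BPoly :=
  bind₁ (fun i => C (A i 0) * Px + C (A i 1) * Py) f

/-- `f` is semi-invariant under `A`: `f·A = c·f` for some nonzero scalar `c`. -/
def SemiInv (A : Matrix (Fin 2) (Fin 2) ℂ) (f : BPoly) : Prop :=
  ∃ c : ℂ, c ≠ 0 ∧ matAct A f = C c * f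

/-- The stabilizer of `f` inside `SL(2,ℂ)`: all matrices under which `f` is
semi-invariant. -/
def Stab (f : BPoly) : Set (SpecialLinearGroup (Fin 2) ℂ) :=
  {A | SemiInv (A : Matrix (Fin 2) (Fin 2) ℂ) f}

/-- `f` is a (nonzero) binary form: nonzero and homogeneous of some degree. -/
def IsBinaryForm (f : BPoly) : Prop :=
  f ≠ 0 ∧ ∃ d : ℕ, f.IsHomogeneous d

/-- `f` is `SL(2,ℂ)`-equivalent to `g` up to a nonzero scalar:
`c·(f·A) = g` for some `A ∈ SL(2,ℂ)` and `c ≠ 0`. -/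
def EquivForm (f g : BPoly) : Prop :=
  ∃ A : SpecialLinearGroup (Fin 2) ℂ, ∃ c : ℂ, c ≠ 0 ∧
    C c * matAct (A : Matrix (Fin 2) (Fin 2) ℂ) f = g


/-- The binary quartic with the given coefficients, in decreasing powers of `x`. -/
def quartic (a b c d e : ℂ) : BPoly :=
  C a * Px ^ 4 + C b * Px ^ 3 * Py + C c * Px ^ 2 * Py ^ 2 + C d * Px * Py ^ 3 + C e * Py ^ 4

/-- The normal form `x⁴ + a x²y² + y⁴`. -/
def evenQuartic (a : ℂ) : BPoly := quartic 1 0 a 0 1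

theorem eval_quartic (a b c d e : ℂ) (v : Fin 2 → ℂ) :
    eval v (quartic a b c d e) = a * v 0 ^ 4 + b * v 0 ^ 3 * v 1 + c * v 0 ^ 2 * v 1 ^ 2 +
      d * v 0 * v 1 ^ 3 + e * v 1 ^ 4 := by
  simp [quartic, Px, Py]

theorem quartic_inj {a b c d e a' b' c' d' e' : ℂ} :
    quartic a b c d e = quartic a' b' c' d' e' ↔
      a = a' ∧ b = b' ∧ c = c' ∧ d = d' ∧ e = e' := by
  refine ⟨fun h => ?_, by rintro ⟨rfl, rfl, rfl, rfl, rfl⟩; rfl⟩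
  have key : ∀ x y : ℂ, _ := fun x y => congrArg (eval ![x, y]) h
  simp only [eval_quartic] at key
  have h1 := key 1 0
  have h2 := key 0 1
  have h3 := key 1 1
  have h4 := key 1 (-1)
  have h5 := key 2 1
  simp at h1 h2 h3 h4 h5
  subst h1 h2
  have hc : c = c' := by linear_combination (h3 + h4) / 2
  subst hc
  have hb : b = b' := by linear_combination (h5 - 2 * h3) / 6
  subst hb
  exact ⟨rfl, rfl, rfl, by linear_combination h3, rfl⟩

theorem C_mul_quartic (k a b c d e : ℂ) :
    C k * quartic a b c d e = quartic (k * a) (k * b) (k * c) (k * d) (k * e) := by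
  simp only [quartic, C_mul]; ring

theorem matAct_quartic (p q r s a b c d e : ℂ) :
    matAct !![p, q; r, s] (quartic a b c d e) = quartic
      (a * p ^ 4 + b * p ^ 3 * r + c * p ^ 2 * r ^ 2 + d * p * r ^ 3 + e * r ^ 4)
      (4 * a * p ^ 3 * q + b * (3 * p ^ 2 * q * r + p ^ 3 * s) +
        c * (2 * p * q * r ^ 2 + 2 * p ^ 2 * r * s) + d * (q * r ^ 3 + 3 * p * r ^ 2 * s) +
        4 * e * r ^ 3 * s)
      (6 * a * p ^ 2 * q ^ 2 + b * (3 * p * q ^ 2 * r + 3 * p ^ 2 * q * s) +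
        c * (p ^ 2 * s ^ 2 + 4 * p * q * r * s + q ^ 2 * r ^ 2) +
        d * (3 * p * r * s ^ 2 + 3 * q * r ^ 2 * s) + 6 * e * r ^ 2 * s ^ 2)
      (4 * a * p * q ^ 3 + b * (q ^ 3 * r + 3 * p * q ^ 2 * s) +
        c * (2 * p * q * s ^ 2 + 2 * q ^ 2 * r * s) + d * (p * s ^ 3 + 3 * q * r * s ^ 2) +
        4 * e * r * s ^ 3)
      (a * q ^ 4 + b * q ^ 3 * s + c * q ^ 2 * s ^ 2 + d * q * s ^ 3 + e * s ^ 4) := by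
  have h3 : (C 3 : BPoly) = 3 := map_ofNat C 3
  have h4 : (C 4 : BPoly) = 4 := map_ofNat C 4
  have h6 : (C 6 : BPoly) = 6 := map_ofNat C 6
  have h2 : (C 2 : BPoly) = 2 := map_ofNat C 2
  simp only [matAct, quartic, Px, Py, map_add, map_mul, map_pow, bind₁_X_right, bind₁_C_right,
    Matrix.of_apply, Matrix.cons_val', Matrix.cons_val_zero, Matrix.cons_val_one,
    Matrix.cons_val_fin_one, h2, h3, h4, h6]
  ring

theorem matAct_C_mul (A : Matrix (Fin 2) (Fin 2) ℂ) (k : ℂ) (f : BPoly) :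
    matAct A (C k * f) = C k * matAct A f := by
  simp [matAct]

theorem matAct_mul (A B : Matrix (Fin 2) (Fin 2) ℂ) (f : BPoly) :
    matAct (A * B) f = matAct B (matAct A f) := by
  unfold matAct
  rw [bind₁_bind₁]
  congr 2
  funext i
  simp [Matrix.mul_apply, Fin.sum_univ_two, Px, Py]
  ring

theorem matAct_one (f : BPoly) : matAct 1 f = f := by
  have h : (fun i : Fin 2 => C ((1 : Matrix (Fin 2) (Fin 2) ℂ) i 0) * Px +
      C ((1 : Matrix (Fin 2) (Fin 2) ℂ) i 1) * Py) = (X : Fin 2 → BPoly) := by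
    funext i
    rcases Fin.exists_fin_two.mp ⟨i, rfl⟩ with rfl | rfl <;> simp [Px, Py]
  rw [matAct, h, bind₁_X_left]; rfl

theorem matAct_coe_mul (A B : SpecialLinearGroup (Fin 2) ℂ) (f : BPoly) :
    matAct (A * B : SpecialLinearGroup (Fin 2) ℂ) f = matAct B (matAct A f) :=
  (congrArg (matAct · f) (Matrix.SpecialLinearGroup.coe_mul A B)).trans (matAct_mul _ _ f)

theorem matAct_coe_one (f : BPoly) : matAct (1 : SpecialLinearGroup (Fin 2) ℂ) f = f :=
  (congrArg (matAct · f) Matrix.SpecialLinearGroup.coe_one).trans (matAct_one f)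

theorem matAct_inv_matAct (A : SpecialLinearGroup (Fin 2) ℂ) (f : BPoly) :
    matAct (A⁻¹ : SpecialLinearGroup (Fin 2) ℂ) (matAct (A : Matrix (Fin 2) (Fin 2) ℂ) f) = f := by
  rw [← matAct_coe_mul, mul_inv_cancel, matAct_coe_one]

theorem EquivForm.symm {f g : BPoly} (h : EquivForm f g) : EquivForm g f := by
  obtain ⟨A, c, hc, rfl⟩ := h
  refine ⟨A⁻¹, c⁻¹, inv_ne_zero hc, ?_⟩
  rw [matAct_C_mul, matAct_inv_matAct, ← mul_assoc, ← C_mul, inv_mul_cancel₀ hc, C_1, one_mul]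

theorem EquivForm.trans {f g h : BPoly} (h₁ : EquivForm f g) (h₂ : EquivForm g h) :
    EquivForm f h := by
  obtain ⟨A, c, hc, rfl⟩ := h₁
  obtain ⟨B, d, hd, rfl⟩ := h₂
  refine ⟨A * B, d * c, mul_ne_zero hd hc, ?_⟩
  rw [matAct_C_mul, matAct_coe_mul, C_mul, mul_assoc]

theorem EquivForm.refl (f : BPoly) : EquivForm f f :=
  ⟨1, 1, one_ne_zero, by rw [matAct_coe_one, C_1, one_mul]⟩

theorem EquivForm.squarefree {f g : BPoly} (h : EquivForm f g) (hf : Squarefree f) :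
    Squarefree g := by
  obtain ⟨A, c, hc, rfl⟩ := h.symm
  intro u hu
  have hmul : matAct (A : Matrix (Fin 2) (Fin 2) ℂ) u *
      matAct (A : Matrix (Fin 2) (Fin 2) ℂ) u ∣ C c * matAct (A : Matrix (Fin 2) (Fin 2) ℂ) g := by
    obtain ⟨w, rfl⟩ := hu
    exact ⟨C c * matAct (A : Matrix (Fin 2) (Fin 2) ℂ) w, by simp only [matAct, map_mul]; ring⟩
  have := (hf _ hmul).map (bind₁ fun i =>
    C ((A⁻¹ : SpecialLinearGroup (Fin 2) ℂ) i 0) * Px +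
    C ((A⁻¹ : SpecialLinearGroup (Fin 2) ℂ) i 1) * Py)
  change IsUnit (matAct (A⁻¹ : SpecialLinearGroup (Fin 2) ℂ)
    (matAct (A : Matrix (Fin 2) (Fin 2) ℂ) u)) at this
  rwa [matAct_inv_matAct] at this

theorem stab_conj_mem {f g : BPoly} {A : SpecialLinearGroup (Fin 2) ℂ} {c : ℂ}
    (h : C c * matAct (A : Matrix (Fin 2) (Fin 2) ℂ) f = g)
    {M : SpecialLinearGroup (Fin 2) ℂ} (hM : M ∈ Stab f) :
    A⁻¹ * M * A ∈ Stab g := by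
  obtain ⟨k, hk, hMk⟩ := hM
  refine ⟨k, hk, ?_⟩
  rw [← h, matAct_C_mul, matAct_coe_mul, matAct_coe_mul, matAct_inv_matAct, hMk, matAct_C_mul]
  ring

theorem EquivForm.card_stab {f g : BPoly} (h : EquivForm f g) :
    Nat.card (Stab f) = Nat.card (Stab g) := by
  obtain ⟨A, c, hc, h⟩ := h
  have h' : C c⁻¹ * matAct (A⁻¹ : SpecialLinearGroup (Fin 2) ℂ) g = f := by
    rw [← h, matAct_C_mul, matAct_inv_matAct, ← mul_assoc, ← C_mul, inv_mul_cancel₀ hc, C_1,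
      one_mul]
  refine Nat.card_congr ⟨fun M => ⟨_, stab_conj_mem h M.2⟩,
    fun M => ⟨_, stab_conj_mem h' M.2⟩, fun M => ?_, fun M => ?_⟩ <;>
  · apply Subtype.ext
    dsimp only
    group

theorem exists_eq_quartic {f : BPoly} (hf : f.IsHomogeneous 4) :
    ∃ a b c d e, f = quartic a b c d e := by
  let m : ℕ → Fin 2 →₀ ℕ := fun i => Finsupp.single 0 (4 - i) + Finsupp.single 1 i
  have hmon : ∀ i k, monomial (m i) k = C k * Px ^ (4 - i) * Py ^ i := by
    intro i k
    rw [Px, Py, X_pow_eq_monomial, X_pow_eq_monomial, mul_assoc, monomial_mul, C_mul_monomial]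
    simp [m]
  have hinj : Set.InjOn m (Finset.range 5) := by
    intro i _ j _ hij
    simpa [m] using DFunLike.congr_fun hij 1
  have hsub : f.support ⊆ (Finset.range 5).image m := by
    intro v hv
    have hd : v.degree = 4 := (DFunLike.congr_fun Finsupp.degree_eq_weight_one v).trans
      (hf (mem_support_iff.mp hv))
    rw [Finsupp.degree_eq_sum, Fin.sum_univ_two] at hd
    refine Finset.mem_image.mpr ⟨v 1, Finset.mem_range.mpr (by omega), ?_⟩
    ext i
    fin_cases i
    · simp [m]; omega
    · simp [m]
  refine ⟨coeff (m 0) f, coeff (m 1) f, coeff (m 2) f, coeff (m 3) f, coeff (m 4) f, ?_⟩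
  conv_lhs => rw [f.as_sum]
  rw [Finset.sum_subset hsub (fun v _ hv => by
    rw [notMem_support_iff.mp hv, monomial_zero]), Finset.sum_image hinj]
  simp only [Finset.sum_range_succ, Finset.sum_range_zero, hmon, quartic]
  ring

theorem equivForm_quartic {p q r s k : ℂ} {a b c d e : ℂ} {g : BPoly} (hdet : p * s - q * r = 1)
    (hk : k ≠ 0) (h : C k * matAct !![p, q; r, s] (quartic a b c d e) = g) :
    EquivForm (quartic a b c d e) g :=
  ⟨⟨!![p, q; r, s], by rw [Matrix.det_fin_two_of, hdet]⟩, k, hk, h⟩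

theorem not_isUnit_of_eval_eq_zero {f : BPoly} (v : Fin 2 → ℂ) (h : eval v f = 0) :
    ¬ IsUnit f := fun hu => by
  simpa [h] using hu.map (eval v)

theorem quartic_zero_zero_not_squarefree (c d e : ℂ) : ¬ Squarefree (quartic 0 0 c d e) :=
  fun h => not_isUnit_of_eval_eq_zero 0 (by simp [Py]) (h Py
    ⟨C c * Px ^ 2 + C d * Px * Py + C e * Py ^ 2, by simp only [quartic, C_0]; ring⟩)

theorem quartic_not_squarefree_of_zero_zero (a b c : ℂ) : ¬ Squarefree (quartic a b c 0 0) :=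
  fun h => not_isUnit_of_eval_eq_zero 0 (by simp [Px]) (h Px
    ⟨C a * Px ^ 2 + C b * Px * Py + C c * Py ^ 2, by simp only [quartic, C_0]; ring⟩)

theorem evenQuartic_sq_ne_four {a : ℂ} (h : Squarefree (evenQuartic a)) : a ^ 2 ≠ 4 := by
  intro ha
  have hC2 : (C 2 : BPoly) = 2 := map_ofNat C 2
  have : (a - 2) * (a + 2) = 0 := by linear_combination ha
  rcases mul_eq_zero.mp this with h' | h'
  · obtain rfl : a = 2 := by linear_combination h'
    exact not_isUnit_of_eval_eq_zero 0 (by simp [Px, Py]) (h (Px ^ 2 + Py ^ 2)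
      ⟨1, by simp only [evenQuartic, quartic, C_0, C_1, hC2]; ring⟩)
  · obtain rfl : a = -2 := by linear_combination h'
    exact not_isUnit_of_eval_eq_zero 0 (by simp [Px, Py]) (h (Px ^ 2 - Py ^ 2)
      ⟨1, by simp only [evenQuartic, quartic, C_0, C_1, C_neg, hC2]; ring⟩)

theorem exists_quartic_root {a : ℂ} (ha : a ≠ 0) (b c d e : ℂ) :
    ∃ t, a * t ^ 4 + b * t ^ 3 + c * t ^ 2 + d * t + e = 0 := by
  have hdeg : (Polynomial.C a * Polynomial.X ^ 4 + Polynomial.C b * Polynomial.X ^ 3 +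
      Polynomial.C c * Polynomial.X ^ 2 + Polynomial.C d * Polynomial.X +
      Polynomial.C e).degree = 4 := by compute_degree!
  obtain ⟨t, ht⟩ := IsAlgClosed.exists_root _ (by rw [hdeg]; decide)
  exact ⟨t, by simpa [Polynomial.IsRoot] using ht⟩

theorem exists_cubic_root {b : ℂ} (hb : b ≠ 0) (c d e : ℂ) :
    ∃ t, b * t ^ 3 + c * t ^ 2 + d * t + e = 0 := by
  have hdeg : (Polynomial.C b * Polynomial.X ^ 3 + Polynomial.C c * Polynomial.X ^ 2 +
      Polynomial.C d * Polynomial.X + Polynomial.C e).degree = 3 := by compute_degree!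
  obtain ⟨t, ht⟩ := IsAlgClosed.exists_root _ (by rw [hdeg]; decide)
  exact ⟨t, by simpa [Polynomial.IsRoot] using ht⟩

theorem exists_ne_zero_pow_four_mul {a e : ℂ} (ha : a ≠ 0) (he : e ≠ 0) :
    ∃ m : ℂ, m ≠ 0 ∧ a * m ^ 4 = e := by
  obtain ⟨m, hm⟩ := IsAlgClosed.exists_pow_nat_eq (e / a) (n := 4) (by norm_num)
  refine ⟨m, ?_, by rw [hm]; field_simp⟩
  rintro rfl
  exact div_ne_zero he ha (by rw [← hm]; norm_num)

theorem exists_equivForm_quartic_zero_left (a b c d e : ℂ) :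
    ∃ b' c' d' e', EquivForm (quartic a b c d e) (quartic 0 b' c' d' e') := by
  by_cases ha : a = 0
  · exact ⟨b, c, d, e, ha ▸ EquivForm.refl _⟩
  obtain ⟨t, ht⟩ := exists_quartic_root ha b c d e
  iterate 4 apply Exists.intro
  refine equivForm_quartic (p := t) (q := -1) (r := 1) (s := 0) (by ring)
    one_ne_zero ?_
  rw [C_1, one_mul, matAct_quartic, quartic_inj]
  exact ⟨by linear_combination ht, rfl, rfl, rfl, rfl⟩

theorem exists_equivForm_quartic_zero_right {b : ℂ} (hb : b ≠ 0) (c d e : ℂ) :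
    ∃ c' d', EquivForm (quartic 0 b c d e) (quartic 0 b c' d' 0) := by
  obtain ⟨t, ht⟩ := exists_cubic_root hb c d e
  iterate 2 apply Exists.intro
  refine equivForm_quartic (p := 1) (q := t) (r := 0) (s := 1) (by ring)
    one_ne_zero ?_
  rw [C_1, one_mul, matAct_quartic, quartic_inj]
  exact ⟨by ring, by ring, rfl, rfl, by linear_combination ht⟩

theorem exists_equivForm_quartic_balanced {b d : ℂ} (hb : b ≠ 0) (hd : d ≠ 0) (c : ℂ) :
    ∃ k, EquivForm (quartic 0 b c d 0) (quartic 0 k c k 0) := by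
  obtain ⟨m, hm, h⟩ := exists_ne_zero_pow_four_mul hb hd
  refine ⟨b * m ^ 2, equivForm_quartic (p := m) (q := 0) (r := 0) (s := m⁻¹) (by field_simp; ring)
    one_ne_zero ?_⟩
  rw [C_1, one_mul, matAct_quartic, quartic_inj]
  refine ⟨by ring, by field_simp; ring, by field_simp; ring, ?_, by ring⟩
  field_simp
  linear_combination -m * h

theorem exists_equivForm_quartic_even (k c : ℂ) :
    ∃ a' c' e', EquivForm (quartic 0 k c k 0) (quartic a' 0 c' 0 e') := by
  iterate 3 apply Exists.intro
  refine equivForm_quartic (p := 1) (q := 1 / 2) (r := -1) (s := 1 / 2) (by norm_num)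
    one_ne_zero ?_
  rw [C_1, one_mul, matAct_quartic, quartic_inj]
  exact ⟨rfl, by ring, rfl, by ring, rfl⟩

theorem exists_equivForm_evenQuartic_of_even {a e : ℂ} (ha : a ≠ 0) (he : e ≠ 0) (c : ℂ) :
    ∃ c', EquivForm (quartic a 0 c 0 e) (evenQuartic c') := by
  obtain ⟨m, hm, h⟩ := exists_ne_zero_pow_four_mul ha he
  obtain ⟨n, rfl⟩ := IsAlgClosed.exists_pow_nat_eq m (n := 2) (by norm_num)
  have hn : n ≠ 0 := by rintro rfl; exact hm (by norm_num)
  apply Exists.intro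
  refine equivForm_quartic (p := n) (q := 0) (r := 0) (s := n⁻¹) (k := (a * n ^ 4)⁻¹)
    (by field_simp; ring) (by positivity) ?_
  rw [matAct_quartic, C_mul_quartic, evenQuartic, quartic_inj]
  refine ⟨by field_simp; ring, by ring, rfl, by ring, ?_⟩
  field_simp
  linear_combination -h

theorem exists_equivForm_evenQuartic {f : BPoly} (hf : f.IsHomogeneous 4) (hsf : Squarefree f) :
    ∃ a, a ^ 2 ≠ 4 ∧ EquivForm f (evenQuartic a) := by
  obtain ⟨a, b, c, d, e, rfl⟩ := exists_eq_quartic hf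
  obtain ⟨b, c, d, e, h₁⟩ := exists_equivForm_quartic_zero_left a b c d e
  have hb : b ≠ 0 := by
    rintro rfl; exact quartic_zero_zero_not_squarefree _ _ _ (h₁.squarefree hsf)
  obtain ⟨c, d, h₂⟩ := exists_equivForm_quartic_zero_right hb c d e
  replace h₂ := h₁.trans h₂
  have hd : d ≠ 0 := by
    rintro rfl; exact quartic_not_squarefree_of_zero_zero _ _ _ (h₂.squarefree hsf)
  obtain ⟨k, h₃⟩ := exists_equivForm_quartic_balanced hb hd c
  obtain ⟨a, c, e, h₄⟩ := exists_equivForm_quartic_even k c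
  replace h₄ := (h₂.trans h₃).trans h₄
  have ha : a ≠ 0 := by
    rintro rfl; exact quartic_zero_zero_not_squarefree _ _ _ (h₄.squarefree hsf)
  have he : e ≠ 0 := by
    rintro rfl; exact quartic_not_squarefree_of_zero_zero _ _ _ (h₄.squarefree hsf)
  obtain ⟨c, h₅⟩ := exists_equivForm_evenQuartic_of_even ha he c
  exact ⟨c, evenQuartic_sq_ne_four ((h₄.trans h₅).squarefree hsf), h₄.trans h₅⟩

theorem evenQuartic_equivForm_neg (a : ℂ) :
    EquivForm (evenQuartic a) (evenQuartic (-a)) := by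
  obtain ⟨z, hz⟩ := IsAlgClosed.exists_pow_nat_eq (-1 : ℂ) (n := 4) (by norm_num)
  refine equivForm_quartic (p := z) (q := 0) (r := 0) (s := -z ^ 3) (k := -1)
    (by linear_combination -hz) (by norm_num) ?_
  rw [matAct_quartic, C_mul_quartic, evenQuartic, quartic_inj]
  refine ⟨by linear_combination -hz, by ring, ?_, by ring, ?_⟩
  · linear_combination (-a * (z ^ 4 - 1)) * hz
  · linear_combination (-(z ^ 8 - z ^ 4 + 1)) * hz

theorem evenQuartic_equivForm_zero {a : ℂ} (ha : a ^ 2 = 36) :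
    EquivForm (evenQuartic a) (evenQuartic 0) := by
  have h6 : EquivForm (evenQuartic 6) (evenQuartic 0) := by
    obtain ⟨w, hw⟩ := IsAlgClosed.exists_pow_nat_eq (-1 / 2 : ℂ) (n := 2) (by norm_num)
    refine equivForm_quartic (p := w) (q := w) (r := w) (s := -w) (k := 1 / 2)
      (by linear_combination -2 * hw) (by norm_num) ?_
    rw [matAct_quartic, C_mul_quartic, evenQuartic, quartic_inj]
    have hw4 : 4 * w ^ 4 = 1 := by linear_combination (4 * w ^ 2 - 2) * hw
    exact ⟨by linear_combination hw4, by ring, by ring, by ring, by linear_combination hw4⟩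
  have h : (a - 6) * (a + 6) = 0 := by linear_combination ha
  rcases mul_eq_zero.mp h with h | h
  · rwa [sub_eq_zero.mp h]
  · rw [eq_neg_of_add_eq_zero_left h]
    simpa using (evenQuartic_equivForm_neg (-6)).trans (by simpa using h6)

/-- A matrix semi-preserving `x⁴ + a x²y² + y⁴`, in terms of its entries. -/
theorem semiInv_evenQuartic_iff {a p q r s : ℂ} (hdet : p * s - q * r = 1) :
    SemiInv !![p, q; r, s] (evenQuartic a) ↔
      4 * p ^ 3 * q + a * (2 * p * q * r ^ 2 + 2 * p ^ 2 * r * s) + 4 * r ^ 3 * s = 0 ∧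
      4 * p * q ^ 3 + a * (2 * p * q * s ^ 2 + 2 * q ^ 2 * r * s) + 4 * r * s ^ 3 = 0 ∧
      p ^ 4 + a * p ^ 2 * r ^ 2 + r ^ 4 = q ^ 4 + a * q ^ 2 * s ^ 2 + s ^ 4 ∧
      6 * p ^ 2 * q ^ 2 + a * (p ^ 2 * s ^ 2 + 4 * p * q * r * s + q ^ 2 * r ^ 2) +
        6 * r ^ 2 * s ^ 2 = a * (p ^ 4 + a * p ^ 2 * r ^ 2 + r ^ 4) := by
  constructor
  · rintro ⟨c, -, h⟩
    rw [evenQuartic, matAct_quartic, C_mul_quartic, quartic_inj] at h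
    obtain ⟨h0, h1, h2, h3, h4⟩ := h
    exact ⟨by linear_combination h1, by linear_combination h3, by linear_combination h0 - h4,
      by linear_combination h2 - a * h0⟩
  · rintro ⟨h1, h3, h4, h2⟩
    have h : matAct !![p, q; r, s] (evenQuartic a) =
        C (p ^ 4 + a * p ^ 2 * r ^ 2 + r ^ 4) * evenQuartic a := by
      rw [evenQuartic, matAct_quartic, C_mul_quartic, quartic_inj]
      exact ⟨by ring, by linear_combination h1, by linear_combination h2,
        by linear_combination h3, by linear_combination -h4⟩
    refine ⟨_, fun hc => ?_, h⟩
    rw [hc, C_0, zero_mul] at h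
    have h' := matAct_inv_matAct ⟨!![p, q; r, s], by rw [Matrix.det_fin_two_of, hdet]⟩
      (evenQuartic a)
    dsimp only at h'
    rw [h] at h'
    have := congrArg (eval ![1, 0]) h'
    simp [matAct, evenQuartic, eval_quartic] at this

/-- Comparing Hessians: a matrix semi-preserving `x⁴ + a x²y² + y⁴` with `a² ≠ 4` maps `x²y²` to a
combination of `x⁴ + y⁴` and `x²y²`. -/
theorem hessian_relations {a p q r s : ℂ} (ha : a ^ 2 ≠ 4) (hdet : p * s - q * r = 1)
    (h1 : 4 * p ^ 3 * q + a * (2 * p * q * r ^ 2 + 2 * p ^ 2 * r * s) + 4 * r ^ 3 * s = 0)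
    (h3 : 4 * p * q ^ 3 + a * (2 * p * q * s ^ 2 + 2 * q ^ 2 * r * s) + 4 * r * s ^ 3 = 0)
    (h4 : p ^ 4 + a * p ^ 2 * r ^ 2 + r ^ 4 = q ^ 4 + a * q ^ 2 * s ^ 2 + s ^ 4) :
    p * r * (p * s + q * r) = 0 ∧ q * s * (p * s + q * r) = 0 ∧
      (p * r - q * s) * (p * r + q * s) = 0 := by
  have ha' : 4 - a ^ 2 ≠ 0 := fun h => ha (by linear_combination -h)
  refine ⟨mul_left_cancel₀ ha' ?_, mul_left_cancel₀ ha' ?_, mul_left_cancel₀ ha' ?_⟩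
  · linear_combination (1 / 6) * (6 * (p ^ 4 + a * p ^ 2 * r ^ 2 + r ^ 4) * h3 -
      (6 * p ^ 2 * q ^ 2 + a * (p ^ 2 * s ^ 2 + 4 * p * q * r * s + q ^ 2 * r ^ 2) +
        6 * r ^ 2 * s ^ 2) * h1 - (8 * a * (p ^ 3 * q + r ^ 3 * s) +
        (12 - a ^ 2) * (2 * p * r * (p * s + q * r))) * (p * s - q * r + 1) * hdet - 2 * a * h1)
  · linear_combination (1 / 6) * (6 * (q ^ 4 + a * q ^ 2 * s ^ 2 + s ^ 4) * h1 -
      (6 * p ^ 2 * q ^ 2 + a * (p ^ 2 * s ^ 2 + 4 * p * q * r * s + q ^ 2 * r ^ 2) +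
        6 * r ^ 2 * s ^ 2) * h3 - (8 * a * (p * q ^ 3 + r * s ^ 3) +
        (12 - a ^ 2) * (2 * q * s * (p * s + q * r))) * (p * s - q * r + 1) * hdet - 2 * a * h3)
  · linear_combination (1 / 3) * (2 * (6 * p ^ 2 * q ^ 2 + a * (p ^ 2 * s ^ 2 +
      4 * p * q * r * s + q ^ 2 * r ^ 2) + 6 * r ^ 2 * s ^ 2) * h4 -
      (3 / 4) * (4 * p ^ 3 * q + a * (2 * p * q * r ^ 2 + 2 * p ^ 2 * r * s) + 4 * r ^ 3 * s) * h1 +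
      (3 / 4) * (4 * p * q ^ 3 + a * (2 * p * q * s ^ 2 + 2 * q ^ 2 * r * s) + 4 * r * s ^ 3) * h3 -
      (2 * a * (p ^ 4 + r ^ 4 - q ^ 4 - s ^ 4) + (12 - a ^ 2) * (p ^ 2 * r ^ 2 - q ^ 2 * s ^ 2)) *
      (p * s - q * r + 1) * hdet - 2 * a * h4)

theorem diagonal_relations {a p s : ℂ} (hdet : p * s = 1) (h4 : p ^ 4 = s ^ 4)
    (h2 : a * (p ^ 2 * s ^ 2) = a * p ^ 4) : p ^ 8 = 1 ∧ (a = 0 ∨ p ^ 4 = 1) := by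
  have hps : p ^ 2 * s ^ 2 = 1 := by rw [← mul_pow, hdet, one_pow]
  refine ⟨by linear_combination p ^ 4 * h4 + (p ^ 2 * s ^ 2 + 1) * hps, ?_⟩
  rw [← sub_eq_zero (a := p ^ 4), ← mul_eq_zero]
  linear_combination -h2 + a * hps

theorem tetrahedral_relations {a p q r s : ℂ} (ha : a ^ 2 ≠ 4) (hdet : p * s - q * r = 1)
    (hsum : p * s + q * r = 0) (hsq : (p * r - q * s) * (p * r + q * s) = 0)
    (h1 : 4 * p ^ 3 * q + a * (2 * p * q * r ^ 2 + 2 * p ^ 2 * r * s) + 4 * r ^ 3 * s = 0)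
    (h2 : 6 * p ^ 2 * q ^ 2 + a * (p ^ 2 * s ^ 2 + 4 * p * q * r * s + q ^ 2 * r ^ 2) +
        6 * r ^ 2 * s ^ 2 = a * (p ^ 4 + a * p ^ 2 * r ^ 2 + r ^ 4)) :
    (p ^ 4 = -1 / 4 ∧ q ^ 4 = -1 / 4 ∧ a ^ 2 = -12 ∧ r = 2 * q ^ 3 ∧ s = -2 * p ^ 3) ∨
    a ^ 2 = 36 := by
  have hps : p * s = 1 / 2 := by linear_combination (hdet + hsum) / 2
  have hqr : q * r = -1 / 2 := by linear_combination (hsum - hdet) / 2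
  obtain ⟨ε, hε, hεpr⟩ : ∃ ε : ℂ, ε ^ 2 = 1 ∧ p * r = ε * (q * s) := by
    rcases mul_eq_zero.mp hsq with h | h
    · exact ⟨1, by norm_num, by linear_combination h⟩
    · exact ⟨-1, by norm_num, by linear_combination h⟩
  have hq2 : q ^ 2 = -ε * p ^ 2 := by
    linear_combination ε * (2 * p ^ 2 * hqr - 2 * p * q * hεpr - 2 * ε * q ^ 2 * hps) - q ^ 2 * hε
  have hq4 : q ^ 4 = p ^ 4 := by
    linear_combination (q ^ 2 - ε * p ^ 2) * hq2 + p ^ 4 * hε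
  have hpq : 16 * (p ^ 4 * q ^ 4) = 1 := by
    have hr : q ^ 3 * r ^ 3 = -1 / 8 := by rw [← mul_pow, hqr]; norm_num
    linear_combination 4 * p * q ^ 3 * h1 - 8 * a * p ^ 2 * q ^ 3 * r * hsum -
      16 * p * s * hr + 2 * hps
  obtain ⟨τ, hτ, hp4⟩ : ∃ τ : ℂ, (τ - 1) * (τ + 1) = 0 ∧ p ^ 4 = τ / 4 :=
    ⟨4 * p ^ 4, by linear_combination hpq - 16 * p ^ 4 * hq4, by ring⟩
  have hτ2 : τ ^ 2 = 1 := by linear_combination hτ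
  have hs : s = 2 * τ * p ^ 3 := by
    linear_combination -s * hτ2 - 4 * τ * s * hp4 + 4 * τ * p ^ 3 * hps
  have hr : r = -2 * τ * q ^ 3 := by
    linear_combination -r * hτ2 - 4 * τ * r * (hq4.trans hp4) + 4 * τ * q ^ 3 * hqr
  have key : a ^ 2 - 2 * ε * a * (1 + τ) - 12 * τ = 0 := by
    have e1 : p ^ 2 * q ^ 2 = -ε * τ / 4 := by rw [hq2]; linear_combination -ε * hp4
    have e2 : p ^ 2 * r ^ 2 = -ε / 4 := by
      have : p ^ 2 * r ^ 2 = 4 * τ ^ 2 * q ^ 4 * (p ^ 2 * q ^ 2) := by rw [hr]; ring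
      rw [this, e1, hq4, hp4]
      linear_combination (-ε * (τ ^ 2 + 1) / 4) * hτ2
    have e3 : r ^ 4 = τ / 4 := by
      have : r ^ 4 = 16 * τ ^ 4 * (q ^ 4) ^ 3 := by rw [hr]; ring
      rw [this, hq4, hp4]
      linear_combination (τ * (τ ^ 4 + τ ^ 2 + 1) / 4) * hτ2
    have e4 : r ^ 2 * s ^ 2 = -ε * τ / 4 := by
      have : r ^ 2 * s ^ 2 = 16 * τ ^ 4 * p ^ 4 * q ^ 4 * (p ^ 2 * q ^ 2) := by
        rw [hr, hs]; ring
      rw [this, e1, hq4, hp4]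
      linear_combination (-ε * τ * (τ ^ 4 + τ ^ 2 + 1) / 4) * hτ2
    have e5 : p ^ 2 * s ^ 2 + 4 * p * q * r * s + q ^ 2 * r ^ 2 = -1 / 2 := by
      linear_combination (p * s + q * r) * hsum + 2 * q * r * hps + hqr
    rw [e5, e3, hp4] at h2
    linear_combination 4 * ε * h2 - 24 * ε * (e1 + e4) + 4 * ε * a ^ 2 * e2 +
      (12 * τ - a ^ 2) * hε
  rcases mul_eq_zero.mp hτ with h | h
  · obtain rfl : τ = 1 := by linear_combination h
    have h' : (a - 6 * ε) * (a + 2 * ε) = 0 := by linear_combination key - 12 * hε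
    rcases mul_eq_zero.mp h' with h' | h'
    · exact Or.inr (by linear_combination (a + 6 * ε) * h' + 36 * hε)
    · exact absurd (by linear_combination (a - 2 * ε) * h' + 4 * hε) ha
  · obtain rfl : τ = -1 := by linear_combination h
    exact Or.inl ⟨by rw [hp4], by rw [hq4, hp4], by linear_combination key,
      by linear_combination hr, by linear_combination hs⟩

theorem semiInv_evenQuartic_cases {a p q r s : ℂ} (ha : a ^ 2 ≠ 4) (hdet : p * s - q * r = 1)
    (h : SemiInv !![p, q; r, s] (evenQuartic a)) :
    (q = 0 ∧ r = 0 ∧ p * s = 1 ∧ p ^ 8 = 1 ∧ (a = 0 ∨ p ^ 4 = 1)) ∨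
    (p = 0 ∧ s = 0 ∧ q * r = -1 ∧ q ^ 8 = 1 ∧ (a = 0 ∨ q ^ 4 = 1)) ∨
    (p ^ 4 = -1 / 4 ∧ q ^ 4 = -1 / 4 ∧ a ^ 2 = -12 ∧ r = 2 * q ^ 3 ∧ s = -2 * p ^ 3) ∨
    a ^ 2 = 36 := by
  obtain ⟨h1, h3, h4, h2⟩ := (semiInv_evenQuartic_iff hdet).mp h
  obtain ⟨hpr, hqs, hsq⟩ := hessian_relations ha hdet h1 h3 h4
  by_cases hsum : p * s + q * r = 0
  · exact Or.inr (Or.inr (tetrahedral_relations ha hdet hsum hsq h1 h2))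
  replace hpr := (mul_eq_zero.mp hpr).resolve_right hsum
  replace hqs := (mul_eq_zero.mp hqs).resolve_right hsum
  rcases mul_eq_zero.mp hpr with rfl | rfl
  · have hq : q ≠ 0 := by rintro rfl; norm_num at hdet
    obtain rfl : s = 0 := (mul_eq_zero.mp hqs).resolve_left hq
    exact Or.inr (Or.inl ⟨rfl, rfl, by linear_combination -hdet,
      diagonal_relations (s := -r) (by linear_combination hdet) (by linear_combination -h4)
        (by linear_combination h2 + a * h4)⟩)
  · have hs : s ≠ 0 := by rintro rfl; norm_num at hdet
    obtain rfl : q = 0 := (mul_eq_zero.mp hqs).resolve_right hs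
    exact Or.inl ⟨rfl, rfl, by linear_combination hdet,
      diagonal_relations (s := s) (by linear_combination hdet) (by linear_combination h4)
        (by linear_combination h2)⟩

/-- The diagonal matrix with entries `z, z⁻¹`. -/
def diagonalSL (z : ℂˣ) : SpecialLinearGroup (Fin 2) ℂ :=
  ⟨!![(z : ℂ), 0; 0, (z : ℂ)⁻¹], by simp [Matrix.det_fin_two_of]⟩

/-- The antidiagonal matrix with entries `z, -z⁻¹`. -/
def antidiagonalSL (z : ℂˣ) : SpecialLinearGroup (Fin 2) ℂ :=
  ⟨!![0, (z : ℂ); -(z : ℂ)⁻¹, 0], by simp [Matrix.det_fin_two_of]⟩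

/-- The matrices of order 3 and 6 in the binary tetrahedral group, parametrized by the pairs of
fourth roots of `-1/4` in their first row. -/
def tetrahedralSL (w : {z : ℂ // z ^ 4 = -1 / 4} × {z : ℂ // z ^ 4 = -1 / 4}) :
    SpecialLinearGroup (Fin 2) ℂ :=
  ⟨!![w.1.1, w.2.1; 2 * w.2.1 ^ 3, -2 * w.1.1 ^ 3], by
    rw [Matrix.det_fin_two_of]; linear_combination -2 * w.1.2 - 2 * w.2.2⟩

theorem diagonalSL_injective : Function.Injective diagonalSL := fun z w h => Units.ext <| by
  simpa [diagonalSL] using congrFun (congrFun (congrArg Subtype.val h) 0) 0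

theorem antidiagonalSL_injective : Function.Injective antidiagonalSL := fun z w h => Units.ext <| by
  simpa [antidiagonalSL] using congrFun (congrFun (congrArg Subtype.val h) 0) 1

theorem tetrahedralSL_injective : Function.Injective tetrahedralSL := fun z w h => by
  have h0 := congrFun (congrFun (congrArg Subtype.val h) 0) 0
  have h1 := congrFun (congrFun (congrArg Subtype.val h) 0) 1
  exact Prod.ext (Subtype.ext (by simpa [tetrahedralSL] using h0))
    (Subtype.ext (by simpa [tetrahedralSL] using h1))

theorem diagonalSL_ne_antidiagonalSL (z w : ℂˣ) : diagonalSL z ≠ antidiagonalSL w := fun h => by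
  simpa [diagonalSL, antidiagonalSL] using congrFun (congrFun (congrArg Subtype.val h) 0) 0

theorem ne_zero_of_pow_four {z : ℂ} (hz : z ^ 4 = -1 / 4) : z ≠ 0 := by
  rintro rfl; norm_num at hz

theorem diagonalSL_ne_tetrahedralSL (z : ℂˣ) (w) : diagonalSL z ≠ tetrahedralSL w := fun h =>
  ne_zero_of_pow_four w.2.2 <| Eq.symm <| by
    simpa [diagonalSL, tetrahedralSL] using congrFun (congrFun (congrArg Subtype.val h) 0) 1

theorem antidiagonalSL_ne_tetrahedralSL (z : ℂˣ) (w) : antidiagonalSL z ≠ tetrahedralSL w :=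
  fun h => ne_zero_of_pow_four w.1.2 <| Eq.symm <| by
    simpa [antidiagonalSL, tetrahedralSL] using congrFun (congrFun (congrArg Subtype.val h) 0) 0

theorem diagonalSL_mem_stab {a : ℂ} {z : ℂˣ} (hz : z ^ 8 = 1) (h : a = 0 ∨ z ^ 4 = 1) :
    diagonalSL z ∈ Stab (evenQuartic a) := by
  refine (semiInv_evenQuartic_iff (by simp)).mpr ?_
  have hz' : (z : ℂ) ^ 8 = 1 := by simpa using congrArg Units.val hz
  refine ⟨by ring, by ring, ?_, ?_⟩
  · field_simp
    linear_combination hz'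
  · rcases h with rfl | h
    · ring
    · have h' : (z : ℂ) ^ 4 = 1 := by simpa using congrArg Units.val h
      field_simp
      linear_combination -a * (z : ℂ) ^ 2 * h'

theorem antidiagonalSL_mem_stab {a : ℂ} {z : ℂˣ} (hz : z ^ 8 = 1) (h : a = 0 ∨ z ^ 4 = 1) :
    antidiagonalSL z ∈ Stab (evenQuartic a) := by
  refine (semiInv_evenQuartic_iff (by simp)).mpr ?_
  have hz' : (z : ℂ) ^ 8 = 1 := by simpa using congrArg Units.val hz
  refine ⟨by ring, by ring, ?_, ?_⟩
  · field_simp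
    linear_combination -hz'
  · rcases h with rfl | h
    · ring
    · have h' : (z : ℂ) ^ 4 = 1 := by simpa using congrArg Units.val h
      field_simp
      linear_combination a * h'

theorem tetrahedralSL_mem_stab {a : ℂ} (ha : a ^ 2 = -12) (w) :
    tetrahedralSL w ∈ Stab (evenQuartic a) := by
  obtain ⟨⟨p, hp⟩, ⟨q, hq⟩⟩ := w
  refine (semiInv_evenQuartic_iff (by linear_combination -2 * hp - 2 * hq)).mpr ?_
  dsimp only
  refine ⟨?_, ?_, ?_, ?_⟩
  · linear_combination (-64 * p ^ 3 * q * (q ^ 4 - 1 / 4)) * hq + 8 * a * p * q ^ 3 * (hq - hp)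
  · linear_combination (-64 * p * q ^ 3 * (p ^ 4 - 1 / 4)) * hp - 8 * a * p ^ 3 * q * (hq - hp)
  · linear_combination 4 * a * p ^ 2 * q ^ 2 * (hq - hp) - 16 * p ^ 4 * (p ^ 4 - 1 / 4) * hp +
      16 * q ^ 4 * (q ^ 4 - 1 / 4) * hq
  · linear_combination 96 * p ^ 2 * q ^ 2 * (q ^ 4 * hp - hq / 4) - 4 * a ^ 2 * p ^ 2 * q ^ 2 * hq +
      p ^ 2 * q ^ 2 * ha + a * (4 * (p ^ 4 - 1 / 4) * hp - 16 * (q ^ 4 * hp - hq / 4) +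
      4 * (q ^ 4 - 1 / 4) * hq - hp - 16 * (q ^ 8 - q ^ 4 / 4 + 1 / 16) * hq)

theorem exists_units_of_mul_eq {p s : ℂ} (h : p * s = 1) :
    ∃ z : ℂˣ, p = z ∧ s = (z : ℂ)⁻¹ :=
  ⟨⟨p, s, h, by rw [mul_comm, h]⟩, rfl, by rw [← Units.val_inv_eq_inv_val]; rfl⟩

theorem mem_stab_evenQuartic_iff {a : ℂ} (h4 : a ^ 2 ≠ 4) (h36 : a ^ 2 ≠ 36)
    (A : SpecialLinearGroup (Fin 2) ℂ) :
    A ∈ Stab (evenQuartic a) ↔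
      (∃ z, (z ^ 8 = 1 ∧ (a = 0 ∨ z ^ 4 = 1)) ∧ diagonalSL z = A) ∨
      (∃ z, (z ^ 8 = 1 ∧ (a = 0 ∨ z ^ 4 = 1)) ∧ antidiagonalSL z = A) ∨
      (a ^ 2 = -12 ∧ ∃ w, tetrahedralSL w = A) := by
  constructor
  · intro hA
    obtain ⟨A, hdet⟩ := A
    obtain ⟨p, q, r, s, rfl⟩ : ∃ p q r s, A = !![p, q; r, s] := ⟨_, _, _, _, A.eta_fin_two⟩
    rcases semiInv_evenQuartic_cases h4 (by rwa [Matrix.det_fin_two_of] at hdet) hA with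
      ⟨rfl, rfl, h, h8, ha⟩ | ⟨rfl, rfl, h, h8, ha⟩ | ⟨hp, hq, ha, rfl, rfl⟩ | ha
    · obtain ⟨z, rfl, rfl⟩ := exists_units_of_mul_eq h
      exact Or.inl ⟨z, by simpa [Units.ext_iff] using And.intro h8 ha, rfl⟩
    · obtain ⟨z, rfl, hr⟩ := exists_units_of_mul_eq (p := q) (s := -r) (by linear_combination -h)
      obtain rfl : r = -(z : ℂ)⁻¹ := by linear_combination -hr
      exact Or.inr (Or.inl ⟨z, by simpa [Units.ext_iff] using And.intro h8 ha, rfl⟩)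
    · exact Or.inr (Or.inr ⟨ha, ⟨⟨p, hp⟩, ⟨q, hq⟩⟩, rfl⟩)
    · exact absurd ha h36
  · rintro (⟨z, ⟨h8, ha⟩, rfl⟩ | ⟨z, ⟨h8, ha⟩, rfl⟩ | ⟨ha, w, rfl⟩)
    · exact diagonalSL_mem_stab h8 ha
    · exact antidiagonalSL_mem_stab h8 ha
    · exact tetrahedralSL_mem_stab ha w

/-- The diagonal and antidiagonal matrices with entries `n`-th roots of unity. -/
def monomialSL (n : ℕ) : rootsOfUnity n ℂ ⊕ rootsOfUnity n ℂ → SpecialLinearGroup (Fin 2) ℂ :=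
  Sum.elim (fun z => diagonalSL z) (fun z => antidiagonalSL z)

theorem monomialSL_injective (n : ℕ) : Function.Injective (monomialSL n) :=
  (diagonalSL_injective.comp Subtype.val_injective).sumElim
    (antidiagonalSL_injective.comp Subtype.val_injective)
    fun _ _ => diagonalSL_ne_antidiagonalSL _ _

theorem card_rootsOfUnity_sum (n : ℕ) [NeZero n] :
    Nat.card (rootsOfUnity n ℂ ⊕ rootsOfUnity n ℂ) = 2 * n := by
  rw [Nat.card_sum, Complex.card_rootsOfUnity, two_mul]

theorem card_pow_four_eq : Nat.card {z : ℂ // z ^ 4 = -1 / 4} = 4 := by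
  obtain ⟨w, hw⟩ := IsAlgClosed.exists_pow_nat_eq (-1 / 4 : ℂ) (n := 4) (by norm_num)
  have hw0 := ne_zero_of_pow_four hw
  refine (Nat.card_congr (Equiv.ofBijective (fun z : rootsOfUnity 4 ℂ =>
    (⟨w * (z : ℂˣ), ?_⟩ : {z : ℂ // z ^ 4 = -1 / 4})) ⟨fun z z' h => ?_, fun z => ?_⟩)).symm.trans
    (Complex.card_rootsOfUnity 4)
  · have := (mem_rootsOfUnity' 4 _).mp z.2
    rw [mul_pow, this, hw, mul_one]
  · exact Subtype.ext (Units.ext (by simpa [hw0] using h))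
  · refine ⟨⟨Units.mk0 (z / w) (div_ne_zero (ne_zero_of_pow_four z.2) hw0), ?_⟩, ?_⟩
    · rw [mem_rootsOfUnity', Units.val_mk0, div_pow, z.2, hw]
      norm_num
    · apply Subtype.ext
      dsimp only [Units.val_mk0]
      field_simp

theorem card_stab_evenQuartic_of_monomial {a : ℂ} {n : ℕ} [NeZero n] (h4 : a ^ 2 ≠ 4)
    (h36 : a ^ 2 ≠ 36) (h12 : a ^ 2 ≠ -12)
    (hn : ∀ z : ℂˣ, z ^ n = 1 ↔ z ^ 8 = 1 ∧ (a = 0 ∨ z ^ 4 = 1)) :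
    Nat.card (Stab (evenQuartic a)) = 2 * n := by
  have : Stab (evenQuartic a) = Set.range (monomialSL n) := by
    ext A
    simp [mem_stab_evenQuartic_iff h4 h36, monomialSL, mem_rootsOfUnity, hn, h12]
  rw [this, Nat.card_range_of_injective (monomialSL_injective n), card_rootsOfUnity_sum]

theorem pow_four_eq_one_iff (z : ℂˣ) : z ^ 4 = 1 ↔ z ^ 8 = 1 ∧ z ^ 4 = 1 :=
  ⟨fun h => ⟨by rw [show 8 = 4 * 2 from rfl, pow_mul, h, one_pow], h⟩, And.right⟩

theorem card_stab_evenQuartic_zero : Nat.card (Stab (evenQuartic 0)) = 16 :=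
  card_stab_evenQuartic_of_monomial (n := 8) (by norm_num) (by norm_num) (by norm_num) (by simp)

theorem card_stab_evenQuartic_generic {a : ℂ} (h0 : a ≠ 0) (h4 : a ^ 2 ≠ 4)
    (h36 : a ^ 2 ≠ 36) (h12 : a ^ 2 ≠ -12) : Nat.card (Stab (evenQuartic a)) = 8 :=
  card_stab_evenQuartic_of_monomial (n := 4) h4 h36 h12 fun z => by
    simpa [h0] using pow_four_eq_one_iff z

theorem card_stab_evenQuartic_equianharmonic {a : ℂ} (ha : a ^ 2 = -12) :
    Nat.card (Stab (evenQuartic a)) = 24 := by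
  have h0 : a ≠ 0 := by rintro rfl; norm_num at ha
  have hrange : Stab (evenQuartic a) = Set.range (Sum.elim (monomialSL 4) tetrahedralSL) := by
    ext A
    simp [mem_stab_evenQuartic_iff (a := a) (by rw [ha]; norm_num) (by rw [ha]; norm_num),
      monomialSL, mem_rootsOfUnity, h0, ha, ← pow_four_eq_one_iff, or_assoc]
  have : Finite {z : ℂ // z ^ 4 = -1 / 4} :=
    Nat.finite_of_card_ne_zero (by rw [card_pow_four_eq]; norm_num)
  rw [hrange, Nat.card_range_of_injective]
  · rw [Nat.card_sum, card_rootsOfUnity_sum, Nat.card_prod, card_pow_four_eq]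
  · refine (monomialSL_injective 4).sumElim tetrahedralSL_injective ?_
    rintro (z | z) w
    · exact diagonalSL_ne_tetrahedralSL _ _
    · exact antidiagonalSL_ne_tetrahedralSL _ _

/-- The stabilizer of a square-free binary quartic has order 8, 16 or 24; the
order exceeds 8 iff the quartic is `SL(2,ℂ)`-equivalent up to scalar to
`x⁴+y⁴` (order 16) or to `x⁴+2√-3 x²y²+y⁴` (order 24), and these two cases are
mutually exclusive. -/
theorem stab_card_squarefree_quartic
    (s3 : ℂ) (hs3 : s3 ^ 2 = -3)
    (f : BPoly) (hf0 : f ≠ 0) (hf4 : f.IsHomogeneous 4) (hsf : Squarefree f) :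
    (Nat.card (Stab f) = 8 ∨ Nat.card (Stab f) = 16 ∨ Nat.card (Stab f) = 24) ∧
    (8 < Nat.card (Stab f) ↔
      (EquivForm f (Px ^ 4 + Py ^ 4) ∨
       EquivForm f (Px ^ 4 + C (2 * s3) * Px ^ 2 * Py ^ 2 + Py ^ 4))) ∧
    (EquivForm f (Px ^ 4 + Py ^ 4) → Nat.card (Stab f) = 16) ∧
    (EquivForm f (Px ^ 4 + C (2 * s3) * Px ^ 2 * Py ^ 2 + Py ^ 4) →
      Nat.card (Stab f) = 24) ∧
    ¬(EquivForm f (Px ^ 4 + Py ^ 4) ∧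
      EquivForm f (Px ^ 4 + C (2 * s3) * Px ^ 2 * Py ^ 2 + Py ^ 4)) := by
  have hg0 : (Px ^ 4 + Py ^ 4 : BPoly) = evenQuartic 0 := by
    simp only [evenQuartic, quartic, C_0, C_1]; ring
  have hg12 : Px ^ 4 + C (2 * s3) * Px ^ 2 * Py ^ 2 + Py ^ 4 = evenQuartic (2 * s3) := by
    simp only [evenQuartic, quartic, C_0, C_1]; ring
  rw [hg0, hg12]
  have h16 : EquivForm f (evenQuartic 0) → Nat.card (Stab f) = 16 := fun h =>
    h.card_stab.trans card_stab_evenQuartic_zero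
  have h24 : EquivForm f (evenQuartic (2 * s3)) → Nat.card (Stab f) = 24 := fun h =>
    h.card_stab.trans (card_stab_evenQuartic_equianharmonic (by linear_combination 4 * hs3))
  have hcases : Nat.card (Stab f) = 8 ∨ EquivForm f (evenQuartic 0) ∨
      EquivForm f (evenQuartic (2 * s3)) := by
    obtain ⟨a, h4, hfa⟩ := exists_equivForm_evenQuartic hf4 hsf
    by_cases h0 : a = 0
    · exact Or.inr (Or.inl (h0 ▸ hfa))
    by_cases h36 : a ^ 2 = 36
    · exact Or.inr (Or.inl (hfa.trans (evenQuartic_equivForm_zero h36)))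
    by_cases h12 : a ^ 2 = -12
    · have h : (a - 2 * s3) * (a + 2 * s3) = 0 := by linear_combination h12 - 4 * hs3
      refine Or.inr (Or.inr ?_)
      rcases mul_eq_zero.mp h with h | h
      · rwa [← sub_eq_zero.mp h]
      · rw [← neg_eq_of_add_eq_zero_right h]
        exact hfa.trans (evenQuartic_equivForm_neg a)
    · exact Or.inl (hfa.card_stab.trans (card_stab_evenQuartic_generic h0 h4 h36 h12))
  refine ⟨?_, ⟨fun h => hcases.resolve_left h.ne', ?_⟩, h16, h24, fun ⟨h, h'⟩ => ?_⟩
  · exact hcases.imp_right (Or.imp h16 h24)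
  · rintro (h | h)
    · rw [h16 h]; norm_num
    · rw [h24 h]; norm_num
  · have := (h16 h).symm.trans (h24 h')
    norm_num at this

end
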